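/- arXiv:1801.01898 — 6 statements merged into one kernel-verified Lean document; each statement's English description precedes it below -/
import Mathlib

section
/- Let X be a normed vector space over ℝ (or ℂ), K a compact subset of X, and let B* denote the closed unit ball of the continuous dual X* equipped with the weak-star topology. Then the restriction map Φ : B* → C(K), Φ(χ) = χ|_K, is continuous from the weak-star topology on B* to the supremum-norm topology on C(K). -/
open NormedSpace

/-- Let `X` be a real normed vector space, `K ⊆ X` compact, and let `B*` be the
closed unit ball of the dual `X*` with the weak-star topology. The restriction map
`Φ : B* → C(K)`, `Φ χ = χ|_K`, is continuous from the weak-star topology into `C(K)` with the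
supremum-norm topology. -/
theorem continuous_restriction_of_weakDual_unitBall
    {X : Type*} [NormedAddCommGroup X] [NormedSpace ℝ X]
    (K : Set X) (hK : IsCompact K) :
    haveI : CompactSpace K := isCompact_iff_compactSpace.mp hK
    Continuous (fun χ : {χ : WeakDual ℝ X // ‖WeakDual.toStrongDual χ‖ ≤ 1} =>
      (⟨fun x : K => (χ : WeakDual ℝ X) x,
        (WeakDual.toStrongDual (χ : WeakDual ℝ X)).continuous.comp
          continuous_subtype_val⟩ : C(K, ℝ))) := by
  have : CompactSpace K := isCompact_iff_compactSpace.mp hK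
  refine ContinuousMap.continuous_of_continuous_uncurry _ ?_
  refine continuous_prod_of_continuous_lipschitzWith'
    (fun p : {χ : WeakDual ℝ X // ‖WeakDual.toStrongDual χ‖ ≤ 1} × K =>
      (p.1 : WeakDual ℝ X) (p.2 : X)) 1 ?_ ?_
  · intro χ
    refine LipschitzWith.of_dist_le_mul fun x y => ?_
    have h := (WeakDual.toStrongDual (χ : WeakDual ℝ X)).le_of_opNorm_le χ.2 ((x : X) - y)
    rw [map_sub] at h
    rw [Subtype.dist_eq, dist_eq_norm, dist_eq_norm]
    exact h
  · intro x
    exact (WeakDual.eval_continuous (x : X)).comp continuous_subtype_val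
end

section
/- Let X be a normed vector space over ℝ (or ℂ), K a compact subset of X, and let B* denote the closed unit ball of the continuous dual X* equipped with the weak-star topology. Then the image {χ|_K : χ ∈ B*} of the restriction map is a compact subset of C(K) in the supremum-norm topology. -/
open NormedSpace

/-- Let `X` be a real normed vector space, `K ⊆ X` compact, and let `B*` be the
closed unit ball of the dual `X*` with the weak-star topology. The image
`{χ|_K : χ ∈ B*}` of the restriction map is a compact subset of `C(K)` in the
supremum-norm topology. -/
theorem isCompact_image_restriction_of_weakDual_unitBall
    {X : Type*} [NormedAddCommGroup X] [NormedSpace ℝ X]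
    (K : Set X) (hK : IsCompact K) :
    haveI : CompactSpace K := isCompact_iff_compactSpace.mp hK
    IsCompact {g : C(K, ℝ) | ∃ χ : WeakDual ℝ X, ‖WeakDual.toStrongDual χ‖ ≤ 1 ∧
      ∀ x : K, g x = χ (x : X)} := by
  haveI : CompactSpace K := isCompact_iff_compactSpace.mp hK
  let B : Set (WeakDual ℝ X) := WeakDual.toStrongDual ⁻¹' Metric.closedBall 0 1
  have hB : IsCompact B := WeakDual.isCompact_closedBall 0 1
  have : CompactSpace B := isCompact_iff_compactSpace.mp hB
  have hnorm : ∀ b : B, ‖WeakDual.toStrongDual b.1‖ ≤ 1 := fun b => 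
    mem_closedBall_zero_iff.mp b.2
  have hlip : ∀ b : B, LipschitzWith 1 (fun x : K => b.1 (x : X)) := fun b => by
    refine LipschitzWith.of_dist_le_mul fun x y => ?_
    have h := (WeakDual.toStrongDual b.1).le_of_opNorm_le (hnorm b) ((x : X) - y)
    rw [map_sub] at h
    rw [Subtype.dist_eq, dist_eq_norm, dist_eq_norm]
    exact h
  have hc : Continuous (fun p : B × K => p.1.1 (p.2 : X)) :=
    continuous_prod_of_continuous_lipschitzWith' _ 1 hlip
      (fun x => (WeakDual.eval_continuous (x : X)).comp continuous_subtype_val)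
  let F : B → C(K, ℝ) := fun b => ⟨fun x => b.1 (x : X), (hlip b).continuous⟩
  have hF : Continuous F :=
    ContinuousMap.continuous_of_continuous_uncurry F hc
  convert isCompact_range hF using 1
  ext g
  constructor
  · rintro ⟨χ, h1, h2⟩
    exact ⟨⟨χ, mem_closedBall_zero_iff.mpr h1⟩, ContinuousMap.ext fun x => (h2 x).symm⟩
  · rintro ⟨b, rfl⟩
    exact ⟨b.1, hnorm b, fun x => rfl⟩
end

section
/- Arzelà–Ascoli theorem for C₀(X): Let X be a locally compact Hausdorff space. A family F ⊆ C₀(X) is relatively compact (in the supremum norm) if and only if (1) F is pointwise bounded, i.e. sup_{f∈F} |f(x)| < ∞ for every x ∈ X; (2) F is equicontinuous, i.e. for every ε > 0 and every x ∈ X there is an open neighbourhood U of x such that |f(y) − f(x)| < ε for all f ∈ F and all y ∈ U; and (3) F is equivanishing, i.e. for every ε > 0 there is a compact set K ⊆ X such that |f(x)| < ε for all f ∈ F and all x ∉ K. -/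
open scoped ZeroAtInfty

lemma C0_abs_sub_le_dist {X : Type*} [TopologicalSpace X] (f g : C₀(X, ℝ)) (x : X) :
    |f x - g x| ≤ dist f g := by
  rw [← ZeroAtInftyContinuousMap.dist_toBCF_eq_dist, ← Real.dist_eq]
  exact BoundedContinuousFunction.dist_coe_le_dist (f := f.toBCF) (g := g.toBCF) x

lemma C0_dist_le {X : Type*} [TopologicalSpace X] (f g : C₀(X, ℝ)) {C : ℝ} (hC : 0 ≤ C)
    (h : ∀ x, |f x - g x| ≤ C) : dist f g ≤ C := by
  rw [← ZeroAtInftyContinuousMap.dist_toBCF_eq_dist]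
  refine (BoundedContinuousFunction.dist_le hC).2 fun x => ?_
  rw [Real.dist_eq]
  exact h x

/-- **Arzelà–Ascoli theorem for `C₀(X)`.** Let `X` be a locally compact Hausdorff
space. A family `F ⊆ C₀(X)` is relatively compact in the supremum norm if and only if it is
pointwise bounded, equicontinuous and equivanishing. -/
theorem isCompact_closure_iff_arzela_ascoli_C0
    {X : Type*} [TopologicalSpace X] [LocallyCompactSpace X] [T2Space X]
    (F : Set C₀(X, ℝ)) :
    IsCompact (closure F) ↔
      ((∀ x : X, ∃ M : ℝ, ∀ f ∈ F, |f x| ≤ M) ∧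
       (∀ ε > (0 : ℝ), ∀ x : X, ∃ U : Set X, IsOpen U ∧ x ∈ U ∧
          ∀ f ∈ F, ∀ y ∈ U, |f y - f x| < ε) ∧
       (∀ ε > (0 : ℝ), ∃ K : Set X, IsCompact K ∧
          ∀ f ∈ F, ∀ x ∉ K, |f x| < ε)) := by
  constructor
  · intro hc
    have htb : TotallyBounded F := hc.totallyBounded.subset subset_closure
    rw [Metric.totallyBounded_iff] at htb
    refine ⟨fun x => ?_, fun ε hε x => ?_, fun ε hε => ?_⟩
    · obtain ⟨C, hC⟩ := (hc.isBounded.subset subset_closure).subset_closedBall (0 : C₀(X, ℝ))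
      refine ⟨C, fun f hf => ?_⟩
      have h1 := C0_abs_sub_le_dist f 0 x
      have h2 := Metric.mem_closedBall.1 (hC hf)
      simp only [ZeroAtInftyContinuousMap.zero_apply, sub_zero] at h1
      exact h1.trans h2
    · obtain ⟨t, ht, hF⟩ := htb (ε / 3) (by linarith)
      refine ⟨⋂ g ∈ t, {y | |g y - g x| < ε / 3}, ?_, ?_, ?_⟩
      · refine ht.isOpen_biInter fun g _ => ?_
        have := map_continuous g
        exact isOpen_lt (by fun_prop) continuous_const
      · simp only [Set.mem_iInter, Set.mem_ofPred_eq, sub_self, abs_zero]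
        intro _ _; linarith
      · intro f hf y hy
        obtain ⟨g, hg, hfg⟩ := Set.mem_iUnion₂.1 (hF hf)
        have h0 := Set.mem_iInter₂.1 hy g hg
        have h1 := C0_abs_sub_le_dist f g x
        have h2 := C0_abs_sub_le_dist f g y
        rw [Metric.mem_ball] at hfg
        simp only [Set.mem_ofPred_eq] at h0
        grind
    · obtain ⟨t, ht, hF⟩ := htb (ε / 2) (by linarith)
      have key : ∀ g : C₀(X, ℝ), ∃ K : Set X, IsCompact K ∧ ∀ x ∉ K, |g x| < ε / 2 := by
        intro g
        have := (ZeroAtInftyContinuousMapClass.zero_at_infty g).eventually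
          (Metric.ball_mem_nhds (0 : ℝ) (half_pos hε))
        obtain ⟨K, hK, h⟩ := Filter.mem_cocompact.1 this
        refine ⟨K, hK, fun x hx => ?_⟩
        have := h hx
        simpa using this
      choose K hK hKs using key
      refine ⟨⋃ g ∈ t, K g, ht.isCompact_biUnion fun g _ => hK g, fun f hf x hx => ?_⟩
      obtain ⟨g, hg, hfg⟩ := Set.mem_iUnion₂.1 (hF hf)
      have h0 := hKs g x fun h => hx (Set.mem_iUnion₂.2 ⟨g, hg, h⟩)
      have h1 := C0_abs_sub_le_dist f g x
      rw [Metric.mem_ball] at hfg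
      grind
  · rintro ⟨hb, he, hv⟩
    refine TotallyBounded.isCompact_of_isClosed (TotallyBounded.closure ?_) isClosed_closure
    refine Metric.totallyBounded_of_finite_discretization fun ε hε => ?_
    obtain ⟨δ, hδ, hδε⟩ : ∃ δ > 0, 3 * δ < ε := ⟨ε / 4, by linarith, by linarith⟩
    obtain ⟨K, hK, hKv⟩ := hv δ hδ
    choose U hUo hxU hU using he δ hδ
    choose M hM using hb
    obtain ⟨t, ht⟩ := hK.elim_finite_subcover U hUo
      fun x _ => Set.mem_iUnion.2 ⟨x, hxU x⟩
    refine ⟨∀ x : t, Set.Icc ⌊-M x / δ⌋ ⌊M x / δ⌋, Fintype.ofFinite _,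
      fun f x => ⟨⌊f.1 x / δ⌋, ?_, ?_⟩, ?_⟩
    · have := abs_le.1 (hM x f.1 f.2)
      exact Int.floor_le_floor (by gcongr; exact this.1)
    · have := abs_le.1 (hM x f.1 f.2)
      exact Int.floor_le_floor (by gcongr; exact this.2)
    · intro f g hfg
      refine (C0_dist_le _ _ (C := 3 * δ) (by positivity) fun x => ?_).trans_lt hδε
      by_cases hx : x ∈ K
      · obtain ⟨z, hz, hxz⟩ := Set.mem_iUnion₂.1 (ht hx)
        have h1 := hU z f.1 f.2 x hxz
        have h2 := hU z g.1 g.2 x hxz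
        have h3 : ⌊f.1 z / δ⌋ = ⌊g.1 z / δ⌋ := congrArg Subtype.val (congrFun hfg ⟨z, hz⟩)
        have h4 := Int.abs_sub_lt_one_of_floor_eq_floor h3
        rw [← sub_div, abs_div, abs_of_pos hδ, div_lt_one hδ] at h4
        grind
      · have h1 := hKv f.1 f.2 x hx
        have h2 := hKv g.1 g.2 x hx
        grind
end

section
/- Let G be a locally compact Hausdorff group with left-invariant Haar measure μ, let 1 ≤ p < ∞, and let φ ∈ C_c(G) satisfy φ(e) ≠ 0. If F ⊆ Lᵖ(G) is Lᵖ-equivanishing, then F⋆φ = {f⋆φ : f ∈ F} is equivanishing: for every ε > 0 there exists a compact set D ⊆ G such that |f⋆φ(x)| < ε for all f ∈ F and all x ∉ D. -/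
open MeasureTheory
open scoped ENNReal

/-- Let `G` be a locally compact Hausdorff group with left Haar measure `μ`,
`1 ≤ p < ∞`, and `φ ∈ C_c(G)` with `φ(e) ≠ 0`. If `F ⊆ Lᵖ(G)` is `Lᵖ`-equivanishing, then
`F⋆φ` is equivanishing: for every `ε > 0` there is a compact `D ⊆ G` with `|f⋆φ(x)| < ε` for
all `f ∈ F` and all `x ∉ D`. -/
theorem convolution_family_equivanishing_of_Lp_equivanishing
    {G : Type*} [Group G] [TopologicalSpace G] [IsTopologicalGroup G]
    [LocallyCompactSpace G] [T2Space G] [MeasurableSpace G] [BorelSpace G]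
    (μ : Measure G) [μ.IsHaarMeasure]
    (p : ℝ≥0∞) (hp1 : 1 ≤ p) (hp : p ≠ ∞)
    (φ : G → ℝ) (hφ : Continuous φ) (hφc : HasCompactSupport φ) (hφe : φ 1 ≠ 0)
    (F : Set (G → ℝ)) (hF : ∀ f ∈ F, MemLp f p μ)
    (hFvan : ∀ ε > (0 : ℝ), ∃ K : Set G, IsCompact K ∧
      ∀ f ∈ F, ∫ y in Kᶜ, |f y| ^ p.toReal ∂μ < ε ^ p.toReal) :
    ∀ ε > (0 : ℝ), ∃ D : Set G, IsCompact D ∧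
      ∀ f ∈ F, ∀ x ∉ D, |∫ y, f y * φ (y⁻¹ * x) ∂μ| < ε := by
  intro ε hε
  set ψ : G → ℝ := fun z => φ z⁻¹ with hψ
  have hψc : Continuous ψ := hφ.comp continuous_inv
  have hψs : HasCompactSupport ψ := hφc.comp_homeomorph (Homeomorph.inv G)
  set q : ℝ≥0∞ := ENNReal.conjExponent p with hq
  have hpq : ENNReal.HolderConjugate p q := ENNReal.HolderConjugate.conjExponent hp1
  have hψL : MemLp ψ q μ := hψc.memLp_of_hasCompactSupport hψs
  set C : ℝ := (eLpNorm ψ q μ).toReal with hC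
  have hC0 : 0 ≤ C := ENNReal.toReal_nonneg
  have hδ : 0 < ε / (C + 1) := by positivity
  obtain ⟨K, hK, hKF⟩ := hFvan _ hδ
  open scoped Pointwise in
  refine ⟨K * tsupport φ, hK.mul hφc, ?_⟩
  intro f hf x hx
  have hp0 : p ≠ 0 := (zero_lt_one.trans_le hp1).ne'
  have hpr : 0 < p.toReal := ENNReal.toReal_pos hp0 hp
  have hKm : MeasurableSet Kᶜ := hK.measurableSet.compl
  set g : G → ℝ := Set.indicator Kᶜ f with hg
  have hfg : ∀ y, f y * φ (y⁻¹ * x) = g y * ψ (x⁻¹ * y) := by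
    intro y
    have h1 : ψ (x⁻¹ * y) = φ (y⁻¹ * x) := by simp [hψ]
    rw [h1]
    by_cases hy : y ∈ K
    · have : φ (y⁻¹ * x) = 0 := by
        by_contra h
        exact hx ⟨y, hy, y⁻¹ * x, subset_tsupport _ h, by simp⟩
      simp [this]
    · simp [hg, hy]
  have hgp : eLpNorm g p μ < ENNReal.ofReal (ε / (C + 1)) := by
    rw [hg, eLpNorm_indicator_eq_eLpNorm_restrict hKm,
      ((hF f hf).restrict Kᶜ).eLpNorm_eq_integral_rpow_norm hp0 hp]
    refine (ENNReal.ofReal_lt_ofReal_iff hδ).2 ?_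
    have h := hKF f hf
    have h0 : 0 ≤ ∫ y in Kᶜ, |f y| ^ p.toReal ∂μ :=
      integral_nonneg fun y => by positivity
    have := Real.rpow_lt_rpow h0 h (inv_pos.2 hpr)
    rwa [Real.rpow_rpow_inv hδ.le hpr.ne'] at this
  have hgm : AEStronglyMeasurable g μ := (hF f hf).1.indicator hKm
  have htr : eLpNorm (fun y => ψ (x⁻¹ * y)) q μ = eLpNorm ψ q μ :=
    eLpNorm_comp_measurePreserving hψL.1 (measurePreserving_mul_left μ x⁻¹)
  have hψm : AEStronglyMeasurable (fun y => ψ (x⁻¹ * y)) μ :=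
    hψL.1.comp_measurePreserving (measurePreserving_mul_left μ x⁻¹)
  have hH : eLpNorm (g • fun y => ψ (x⁻¹ * y)) 1 μ ≤
      eLpNorm g p μ * eLpNorm (fun y => ψ (x⁻¹ * y)) q μ :=
    eLpNorm_smul_le_mul_eLpNorm hψm hgm
  simp_rw [hfg]
  have h1 : ENNReal.ofReal |∫ y, g y * ψ (x⁻¹ * y) ∂μ| ≤
      ENNReal.ofReal (ε / (C + 1) * C) := by
    rw [← Real.norm_eq_abs, ofReal_norm]
    refine (enorm_integral_le_lintegral_enorm _).trans ?_
    rw [eLpNorm_one_eq_lintegral_enorm, htr] at hH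
    refine hH.trans ?_
    rw [ENNReal.ofReal_mul hδ.le, hC, ENNReal.ofReal_toReal hψL.2.ne]
    gcongr
  rw [ENNReal.ofReal_le_ofReal_iff (by positivity)] at h1
  refine h1.trans_lt ?_
  rw [div_mul_eq_mul_div, div_lt_iff₀ (by positivity)]
  nlinarith
end

section
/- Let G be a locally compact Hausdorff group with left-invariant Haar measure μ, let 1 ≤ p < ∞, let F ⊆ Lᵖ(G) be bounded in the Lᵖ-norm, let φ ∈ C_c(G), and let K ⊆ G be compact. Then the family F|_K ⋆ φ = {(f·1_K) ⋆ φ : f ∈ F} is relatively compact in C₀(G) (with the supremum norm), where (f·1_K)⋆φ(x) = ∫_K f(y) φ(y⁻¹x) dμ(y). -/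
open MeasureTheory
open scoped ENNReal ZeroAtInfty

/-- Let `G` be a locally compact Hausdorff group with left Haar measure `μ`,
`1 ≤ p < ∞`, `F ⊆ Lᵖ(G)` bounded in `Lᵖ`-norm, `φ ∈ C_c(G)`, and `K ⊆ G` compact. Then the
family `F|_K ⋆ φ = {(f·1_K) ⋆ φ : f ∈ F}` is a relatively compact subset of `C₀(G)` with the
supremum norm. -/
theorem restricted_convolution_family_relatively_compact_in_C0
    {G : Type*} [Group G] [TopologicalSpace G] [IsTopologicalGroup G]
    [LocallyCompactSpace G] [T2Space G] [MeasurableSpace G] [BorelSpace G]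
    (μ : Measure G) [μ.IsHaarMeasure]
    (p : ℝ≥0∞) (hp1 : 1 ≤ p) (hp : p ≠ ∞)
    (F : Set (G → ℝ)) (hF : ∀ f ∈ F, MemLp f p μ)
    (M : ℝ) (hFM : ∀ f ∈ F, eLpNorm f p μ ≤ ENNReal.ofReal M)
    (φ : G → ℝ) (hφ : Continuous φ) (hφc : HasCompactSupport φ)
    (K : Set G) (hK : IsCompact K) :
    ∃ S : Set C₀(G, ℝ),
      (fun h : C₀(G, ℝ) => (h : G → ℝ)) '' S =
        {h : G → ℝ | ∃ f ∈ F, h = fun x => ∫ y in K, f y * φ (y⁻¹ * x) ∂μ} ∧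
      IsCompact (closure S) := by
  classical
  have hKm : MeasurableSet K := hK.measurableSet
  have hKfin : μ K < ∞ := hK.measure_lt_top
  haveI : IsFiniteMeasure (μ.restrict K) := ⟨by simpa using hKfin⟩
  -- uniform L¹ bound on K
  have hint : ∀ f ∈ F, Integrable f (μ.restrict K) := fun f hf =>
    ((hF f hf).restrict K).integrable hp1
  obtain ⟨C, hC0, hC⟩ : ∃ C : ℝ, 0 ≤ C ∧ ∀ f ∈ F, ∫ y in K, ‖f y‖ ∂μ ≤ C := by
    set B : ℝ≥0∞ := ENNReal.ofReal M * (μ.restrict K) Set.univ ^ (1 / (1 : ℝ≥0∞).toReal - 1 / p.toReal)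
      with hB
    have hBtop : B ≠ ∞ := by
      refine ENNReal.mul_ne_top ENNReal.ofReal_ne_top ?_
      refine ENNReal.rpow_ne_top_of_nonneg ?_ (measure_ne_top _ _)
      have h1 : 1 ≤ p.toReal := by
        have := ENNReal.toReal_mono hp hp1
        simpa using this
      have : 1 / p.toReal ≤ 1 := by
        rw [div_le_one (by linarith)]; exact h1
      simpa using this
    refine ⟨B.toReal, ENNReal.toReal_nonneg, fun f hf => ?_⟩
    rw [integral_norm_eq_lintegral_enorm (hint f hf).aestronglyMeasurable]
    refine ENNReal.toReal_mono hBtop ?_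
    rw [← eLpNorm_one_eq_lintegral_enorm]
    refine (eLpNorm_le_eLpNorm_mul_rpow_measure_univ hp1
      (hint f hf).aestronglyMeasurable).trans ?_
    rw [hB]; gcongr
    exact (eLpNorm_mono_measure _ Measure.restrict_le_self).trans (hFM f hf)
  -- basic estimate
  have hest : ∀ f ∈ F, ∀ (ψ : G → ℝ) (δ : ℝ), 0 ≤ δ → (∀ y ∈ K, ‖ψ y‖ ≤ δ) →
      ‖∫ y in K, f y * ψ y ∂μ‖ ≤ δ * C := by
    intro f hf ψ δ hδ hψ
    have h1 : ‖∫ y in K, f y * ψ y ∂μ‖ ≤ ∫ y in K, δ * ‖f y‖ ∂μ := by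
      refine norm_integral_le_of_norm_le ((hint f hf).norm.const_mul δ) ?_
      filter_upwards [ae_restrict_mem hKm] with y hy
      rw [norm_mul, mul_comm]
      exact mul_le_mul_of_nonneg_right (hψ y hy) (norm_nonneg _)
    rw [integral_const_mul] at h1
    exact h1.trans (mul_le_mul_of_nonneg_left (hC f hf) hδ)
  obtain ⟨A, hA⟩ := hφc.exists_bound_of_continuous hφ
  have hA0 : 0 ≤ A := (norm_nonneg _).trans (hA 1)
  have hφx : ∀ x, Continuous fun y : G => φ (y⁻¹ * x) := fun x => by fun_prop
  have hint2 : ∀ f ∈ F, ∀ x, Integrable (fun y => f y * φ (y⁻¹ * x)) (μ.restrict K) := by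
    intro f hf x
    refine (hint f hf).mul_bdd (c := A) ?_ ?_
    · exact (hφx x).measurable.aestronglyMeasurable
    · exact Filter.Eventually.of_forall fun y => hA _
  -- equicontinuity
  have hequi : ∀ x₀ : G, ∀ ε > 0, ∀ᶠ x in nhds x₀, ∀ f ∈ F,
      dist (∫ y in K, f y * φ (y⁻¹ * x₀) ∂μ) (∫ y in K, f y * φ (y⁻¹ * x) ∂μ) < ε := by
    intro x₀ ε hε
    have hδ : 0 < ε / (C + 1) := by positivity
    have := hK.eventually_forall_of_forall_eventually (x₀ := x₀)
      (P := fun x y => ‖φ (y⁻¹ * x₀) - φ (y⁻¹ * x)‖ < ε / (C + 1)) (by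
        intro y _
        have hc : Continuous fun z : G × G => ‖φ (z.2⁻¹ * x₀) - φ (z.2⁻¹ * z.1)‖ := by fun_prop
        exact hc.continuousAt.eventually_lt continuousAt_const (by simpa using hδ))
    filter_upwards [this] with x hx f hf
    rw [dist_eq_norm, ← integral_sub (hint2 f hf x₀) (hint2 f hf x)]
    simp_rw [← mul_sub]
    refine (hest f hf _ _ hδ.le fun y hy => (hx y hy).le).trans_lt ?_
    rw [div_mul_eq_mul_div, div_lt_iff₀ (by positivity)]
    nlinarith
  -- common support
  obtain ⟨L, hL, hsupp⟩ : ∃ L : Set G, IsCompact L ∧ ∀ f : G → ℝ, ∀ x ∉ L,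
      ∫ y in K, f y * φ (y⁻¹ * x) ∂μ = 0 := by
    refine ⟨(fun z : G × G => z.1 * z.2) '' (K ×ˢ tsupport φ),
      (hK.prod hφc).image continuous_mul, fun f x hx => ?_⟩
    refine setIntegral_eq_zero_of_forall_eq_zero fun y hy => ?_
    by_contra h
    apply hx
    refine ⟨(y, y⁻¹ * x), ⟨hy, subset_tsupport _ ?_⟩, by simp⟩
    exact fun h0 => h (by simp [h0])
  let S : Set C₀(G, ℝ) :=
    {g | ∃ f ∈ F, (g : G → ℝ) = fun x => ∫ y in K, f y * φ (y⁻¹ * x) ∂μ}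
  refine ⟨S, ?_, ?_⟩
  · ext h
    constructor
    · rintro ⟨g, ⟨f, hf, hg⟩, rfl⟩
      exact ⟨f, hf, hg⟩
    · rintro ⟨f, hf, rfl⟩
      refine ⟨⟨⟨fun x => ∫ y in K, f y * φ (y⁻¹ * x) ∂μ, ?_⟩, ?_⟩, ⟨f, hf, rfl⟩, rfl⟩
      · rw [continuous_iff_continuousAt]
        intro x₀
        rw [ContinuousAt, Metric.tendsto_nhds]
        intro ε hε
        filter_upwards [hequi x₀ ε hε] with x hx
        rw [dist_comm]
        exact hx f hf
      · refine tendsto_const_nhds.congr' ?_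
        filter_upwards [hL.compl_mem_cocompact] with x hx
        exact (hsupp f x hx).symm
  · haveI : CompactSpace L := isCompact_iff_compactSpace.mp hL
    let r : C₀(G, ℝ) → BoundedContinuousFunction L ℝ := fun g =>
      g.toBCF.compContinuous ⟨Subtype.val, continuous_subtype_val⟩
    have hr : ∀ g (x : L), r g x = g x := fun g x => rfl
    have hcomp : IsCompact (closure (r '' S)) := by
      refine BoundedContinuousFunction.arzela_ascoli (Metric.closedBall 0 (A * C))
        (isCompact_closedBall _ _) _ ?_ ?_
      · rintro _ x ⟨g, ⟨f, hf, hg⟩, rfl⟩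
        rw [hr, hg, mem_closedBall_zero_iff]
        exact hest f hf _ A hA0 fun y _ => hA _
      · intro x₀
        rw [Metric.equicontinuousAt_iff_right]
        intro ε hε
        filter_upwards [continuous_subtype_val.continuousAt.eventually (hequi x₀ ε hε)] with x hx
        rintro ⟨_, g, ⟨f, hf, hg⟩, rfl⟩
        change dist (g x₀) (g x) < ε
        rw [hg]
        exact hx f hf
    have hiso : Isometry fun g : S => r g := by
      refine Isometry.of_dist_eq fun g h => le_antisymm ?_ ?_
      · refine (BoundedContinuousFunction.dist_le dist_nonneg).2 fun x => ?_
        exact BoundedContinuousFunction.dist_coe_le_dist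
          (f := (g : C₀(G, ℝ)).toBCF) (g := (h : C₀(G, ℝ)).toBCF) (x : G)
      · change dist (g : C₀(G, ℝ)).toBCF (h : C₀(G, ℝ)).toBCF ≤ _
        refine (BoundedContinuousFunction.dist_le dist_nonneg).2 fun x => ?_
        by_cases hx : x ∈ L
        · exact BoundedContinuousFunction.dist_coe_le_dist
            (f := r g) (g := r h) ⟨x, hx⟩
        · change dist ((g : C₀(G, ℝ)) x) ((h : C₀(G, ℝ)) x) ≤ _
          obtain ⟨f, hf, hg⟩ := g.2
          obtain ⟨f', hf', hh⟩ := h.2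
          have e1 : (g : C₀(G, ℝ)) x = 0 := by rw [hg]; exact hsupp f x hx
          have e2 : (h : C₀(G, ℝ)) x = 0 := by rw [hh]; exact hsupp f' x hx
          rw [e1, e2, dist_self]
          exact dist_nonneg
    have htb : TotallyBounded (r '' S) := hcomp.totallyBounded.subset subset_closure
    have htb2 : TotallyBounded (Set.univ : Set S) := by
      refine (totallyBounded_preimage hiso.isUniformInducing htb).subset ?_
      intro g _
      exact ⟨g, g.2, rfl⟩
    have htb3 : TotallyBounded S := by
      have := htb2.image (uniformContinuous_subtype_val (p := fun g => g ∈ S))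
      simpa using this
    exact htb3.closure.isCompact_of_isClosed isClosed_closure
end

section
/- Fréchet–Kolmogorov–Riesz theorem: Let 1 ≤ p < ∞ and let F be a bounded subset of Lᵖ(ℝᴺ) such that lim_{|x|→0} ‖R_x f − f‖_p = 0 uniformly in f ∈ F, where R_x f(y) = f(y + x); i.e., for every ε > 0 there exists δ > 0 such that ‖R_x f − f‖_p < ε for all f ∈ F and all x ∈ ℝᴺ with |x| < δ. Then for every measurable set Ω ⊆ ℝᴺ of finite Lebesgue measure, the closure of F|_Ω = {f|_Ω : f ∈ F} in Lᵖ(Ω) is compact. -/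
open MeasureTheory
open scoped ENNReal

lemma fkr_avg {N : ℕ} (p : ℝ≥0∞) (hp1 : 1 ≤ p) (hp : p ≠ ∞) (r : ℝ) (hr : 0 < r) :
    ∃ μ : Measure (EuclideanSpace ℝ (Fin N)), IsProbabilityMeasure μ ∧ μ ≪ volume ∧
      (∀ᵐ y ∂μ, ‖y‖ < r) ∧
      (∀ h : EuclideanSpace ℝ (Fin N) → ℝ, MemLp h p volume → Integrable h μ) ∧
      ∃ C : ℝ, 0 ≤ C ∧ ∀ h : EuclideanSpace ℝ (Fin N) → ℝ, AEStronglyMeasurable h volume →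
        ‖∫ y, h y ∂μ‖ₑ ≤ ENNReal.ofReal C * eLpNorm h p volume := by
  set B := Metric.ball (0 : EuclideanSpace ℝ (Fin N)) r with hB
  have hB0 : volume B ≠ 0 := (Metric.measure_ball_pos volume _ hr).ne'
  have hBt : volume B ≠ ∞ := measure_ball_lt_top.ne
  have hct : (volume B)⁻¹ ≠ ∞ := ENNReal.inv_ne_top.2 hB0
  have hle : (volume B)⁻¹ • (volume.restrict B) ≤ (volume B)⁻¹ • (volume : Measure (EuclideanSpace ℝ (Fin N))) := by
    gcongr
    exact Measure.restrict_le_self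
  have hprob : IsProbabilityMeasure ((volume B)⁻¹ • (volume.restrict B)) := by
    constructor
    simp [ENNReal.inv_mul_cancel hB0 hBt]
  have hac : (volume B)⁻¹ • (volume.restrict B) ≪ (volume : Measure (EuclideanSpace ℝ (Fin N))) :=
    (Measure.absolutelyContinuous_of_le hle).trans Measure.smul_absolutelyContinuous
  refine ⟨(volume B)⁻¹ • (volume.restrict B), hprob, hac, ?_, ?_, ?_⟩
  · apply Measure.ae_smul_measure
    filter_upwards [ae_restrict_mem measurableSet_ball] with y hy
    simpa [hB] using hy
  · intro h hh
    exact (hh.of_measure_le_smul hct hle).integrable hp1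
  · refine ⟨((volume B)⁻¹ ^ (1 / p).toReal).toReal, ENNReal.toReal_nonneg, ?_⟩
    intro h hh
    rw [ENNReal.ofReal_toReal (by finiteness)]
    calc _ ≤ ∫⁻ y, ‖h y‖ₑ ∂((volume B)⁻¹ • (volume.restrict B)) := enorm_integral_le_lintegral_enorm _
      _ = eLpNorm h 1 ((volume B)⁻¹ • (volume.restrict B)) := (eLpNorm_one_eq_lintegral_enorm).symm
      _ ≤ eLpNorm h p ((volume B)⁻¹ • (volume.restrict B)) :=
        eLpNorm_le_eLpNorm_of_exponent_le hp1 (hh.mono_ac hac)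
      _ ≤ eLpNorm h p ((volume B)⁻¹ • volume) := eLpNorm_mono_measure _ hle
      _ = _ := by rw [eLpNorm_smul_measure_of_ne_top hp, smul_eq_mul]

lemma fkr_meas {N : ℕ} (μ : Measure (EuclideanSpace ℝ (Fin N))) [IsProbabilityMeasure μ]
    (f : EuclideanSpace ℝ (Fin N) → ℝ) (hf : AEStronglyMeasurable f volume) :
    AEStronglyMeasurable (fun z : EuclideanSpace ℝ (Fin N) × EuclideanSpace ℝ (Fin N) =>
      f (z.1 + z.2)) (volume.prod μ) := by
  have := hf.comp_quasiMeasurePreserving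
    (quasiMeasurePreserving_add_swap (volume : Measure (EuclideanSpace ℝ (Fin N))) μ)
  simpa [Function.comp_def, add_comm] using this

lemma fkr_dist {N : ℕ} (p : ℝ≥0∞) (hp1 : 1 ≤ p) (hp : p ≠ ∞) (r : ℝ)
    (μ : Measure (EuclideanSpace ℝ (Fin N))) [IsProbabilityMeasure μ] (hac : μ ≪ volume)
    (hμ : ∀ᵐ y ∂μ, ‖y‖ < r)
    (hi : ∀ h : EuclideanSpace ℝ (Fin N) → ℝ, MemLp h p volume → Integrable h μ)
    (f : EuclideanSpace ℝ (Fin N) → ℝ) (hf : MemLp f p volume) (e : ℝ≥0∞)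
    (hfe : ∀ x, ‖x‖ < r → eLpNorm (fun y => f (y + x) - f y) p volume ≤ e) :
    eLpNorm (fun x => (∫ y, f (x + y) ∂μ) - f x) p volume ≤ e := by
  have hp0 : p ≠ 0 := (zero_lt_one.trans_le hp1).ne'
  have hq : 0 < p.toReal := ENNReal.toReal_pos hp0 hp
  have hm := fkr_meas μ f hf.1
  have hm2 : AEStronglyMeasurable (fun z : EuclideanSpace ℝ (Fin N) × EuclideanSpace ℝ (Fin N) =>
      f (z.1 + z.2) - f z.1) (volume.prod μ) := hm.sub hf.1.comp_fst
  have htr : ∀ x, MemLp (fun y => f (x + y)) p volume := fun x =>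
    hf.comp_measurePreserving (measurePreserving_add_left volume x)
  have key : ∀ x, ‖(∫ y, f (x + y) ∂μ) - f x‖ₑ ^ p.toReal ≤
      ∫⁻ y, ‖f (x + y) - f x‖ₑ ^ p.toReal ∂μ := by
    intro x
    have h1 : (∫ y, f (x + y) ∂μ) - f x = ∫ y, (f (x + y) - f x) ∂μ := by
      rw [integral_sub (hi _ (htr x)) (integrable_const _)]
      simp
    have h2 : ‖∫ y, (f (x + y) - f x) ∂μ‖ₑ ≤ eLpNorm (fun y => f (x + y) - f x) p μ := by
      refine (enorm_integral_le_lintegral_enorm _).trans ?_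
      rw [← eLpNorm_one_eq_lintegral_enorm]
      exact eLpNorm_le_eLpNorm_of_exponent_le hp1
        (((htr x).1.mono_ac hac).sub aestronglyMeasurable_const)
    rw [h1]
    refine (ENNReal.rpow_le_rpow h2 hq.le).trans (le_of_eq ?_)
    rw [eLpNorm_eq_lintegral_rpow_enorm_toReal hp0 hp, ← ENNReal.rpow_mul,
      one_div_mul_cancel hq.ne', ENNReal.rpow_one]
  rw [eLpNorm_eq_lintegral_rpow_enorm_toReal hp0 hp, one_div, ENNReal.rpow_inv_le_iff hq]
  calc _ ≤ ∫⁻ x, ∫⁻ y, ‖f (x + y) - f x‖ₑ ^ p.toReal ∂μ ∂volume := lintegral_mono key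
    _ = ∫⁻ y, ∫⁻ x, ‖f (x + y) - f x‖ₑ ^ p.toReal ∂volume ∂μ :=
      lintegral_lintegral_swap (hm2.enorm.pow_const _)
    _ ≤ ∫⁻ y, e ^ p.toReal ∂μ := by
      apply lintegral_mono_ae
      filter_upwards [hμ] with y hy
      have := hfe y hy
      rwa [eLpNorm_eq_lintegral_rpow_enorm_toReal hp0 hp, one_div, ENNReal.rpow_inv_le_iff hq] at this
    _ = _ := by simp

lemma fkr_point {N : ℕ} (p : ℝ≥0∞) (μ : Measure (EuclideanSpace ℝ (Fin N))) (C : ℝ)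
    (hi : ∀ h : EuclideanSpace ℝ (Fin N) → ℝ, MemLp h p volume → Integrable h μ)
    (hC : ∀ h : EuclideanSpace ℝ (Fin N) → ℝ, AEStronglyMeasurable h volume →
        ‖∫ y, h y ∂μ‖ₑ ≤ ENNReal.ofReal C * eLpNorm h p volume)
    (f : EuclideanSpace ℝ (Fin N) → ℝ) (hf : MemLp f p volume) :
    (∀ x, ‖∫ y, f (x + y) ∂μ‖ₑ ≤ ENNReal.ofReal C * eLpNorm f p volume) ∧
    (∀ x x', ‖(∫ y, f (x + y) ∂μ) - ∫ y, f (x' + y) ∂μ‖ₑ ≤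
      ENNReal.ofReal C * eLpNorm (fun y => f (y + (x - x')) - f y) p volume) := by
  have htr : ∀ x, MemLp (fun y => f (x + y)) p volume := fun x =>
    hf.comp_measurePreserving (measurePreserving_add_left volume x)
  constructor
  · intro x
    refine (hC _ (htr x).1).trans (le_of_eq ?_)
    congr 1
    exact eLpNorm_comp_measurePreserving hf.1 (measurePreserving_add_left volume x)
  · intro x x'
    rw [← integral_sub (hi _ (htr x)) (hi _ (htr x'))]
    refine (hC _ ((htr x).sub (htr x')).1).trans (le_of_eq ?_)
    congr 1
    have hm : AEStronglyMeasurable (fun y => f (y + (x - x')) - f y) volume :=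
      (hf.1.comp_measurePreserving (measurePreserving_add_right volume (x - x'))).sub hf.1
    rw [← eLpNorm_comp_measurePreserving hm (measurePreserving_add_left volume x')]
    congr 1
    funext y
    have hxy : x' + y + (x - x') = x + y := by abel
    simp only [Function.comp_apply, Pi.sub_apply, hxy]

/-- **Fréchet–Kolmogorov–Riesz theorem.** Let `1 ≤ p < ∞` and let `F` be a
bounded subset of `Lᵖ(ℝᴺ)` such that `‖R_x f − f‖_p → 0` as `|x| → 0`, uniformly in `f ∈ F`,
where `R_x f (y) = f (y + x)`. Then for every measurable `Ω ⊆ ℝᴺ` of finite Lebesgue measure,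
the closure of `F|_Ω` in `Lᵖ(Ω)` is compact. -/
theorem frechet_kolmogorov_riesz
    (N : ℕ) (p : ℝ≥0∞) [hp1 : Fact (1 ≤ p)] (hp : p ≠ ∞)
    (F : Set (EuclideanSpace ℝ (Fin N) → ℝ))
    (hFmem : ∀ f ∈ F, MemLp f p (volume : Measure (EuclideanSpace ℝ (Fin N))))
    (M : ℝ) (hFbdd : ∀ f ∈ F, eLpNorm f p volume ≤ ENNReal.ofReal M)
    (hFtrans : ∀ ε > (0 : ℝ), ∃ δ > (0 : ℝ), ∀ f ∈ F,
      ∀ x : EuclideanSpace ℝ (Fin N), ‖x‖ < δ →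
        eLpNorm (fun y => f (y + x) - f y) p volume < ENNReal.ofReal ε) :
    ∀ Ω : Set (EuclideanSpace ℝ (Fin N)), MeasurableSet Ω → volume Ω < ∞ →
      IsCompact (closure
        {g : Lp ℝ p ((volume : Measure (EuclideanSpace ℝ (Fin N))).restrict Ω) |
          ∃ f ∈ F, (g : EuclideanSpace ℝ (Fin N) → ℝ) =ᵐ[volume.restrict Ω] f}) := by
  intro Ω hΩ hΩt
  have hp0 : p ≠ 0 := (zero_lt_one.trans_le hp1.out).ne'
  have hq : 0 < p.toReal := ENNReal.toReal_pos hp0 hp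
  suffices h : TotallyBounded {g : Lp ℝ p ((volume : Measure (EuclideanSpace ℝ (Fin N))).restrict Ω) |
          ∃ f ∈ F, (g : EuclideanSpace ℝ (Fin N) → ℝ) =ᵐ[volume.restrict Ω] f} from
    h.closure.isCompact_of_isClosed isClosed_closure
  refine Metric.totallyBounded_of_finite_discretization fun ε hε => ?_
  have he : 0 < ε / 8 := by positivity
  obtain ⟨r, hr, hFr⟩ := hFtrans (ε / 8) he
  obtain ⟨μ, hμp, hac, hμr, hi, C, hC0, hC⟩ := fkr_avg (N := N) p hp1.out hp r hr
  -- constants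
  set b : ℝ := C * max M 0 with hb
  have hb0 : 0 ≤ b := mul_nonneg hC0 (le_max_right _ _)
  have hpt : ∀ f ∈ F, ∀ x, ‖∫ y, f (x + y) ∂μ‖ ≤ b := by
    intro f hf x
    have h1 := (fkr_point p μ C hi hC f (hFmem f hf)).1 x
    have h2 : ‖∫ y, f (x + y) ∂μ‖ₑ ≤ ENNReal.ofReal b := by
      refine h1.trans ?_
      rw [hb, ENNReal.ofReal_mul hC0]
      gcongr
      exact (hFbdd f hf).trans (ENNReal.ofReal_le_ofReal (le_max_left _ _))
    rw [← ofReal_norm] at h2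
    exact (ENNReal.ofReal_le_ofReal_iff hb0).1 h2
  set a : ℝ≥0∞ := volume Ω ^ p.toReal⁻¹ with ha
  have hat : a ≠ ∞ := (ENNReal.rpow_lt_top_of_nonneg (by positivity) hΩt.ne).ne
  set η : ℝ := ε / 8 / (a.toReal + 1) with hη
  have haT : 0 ≤ a.toReal := ENNReal.toReal_nonneg
  have hη0 : 0 < η := by positivity
  have hηa : ENNReal.ofReal η * a ≤ ENNReal.ofReal (ε / 8) := by
    rw [← ENNReal.ofReal_toReal hat, ← ENNReal.ofReal_mul hη0.le]
    apply ENNReal.ofReal_le_ofReal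
    rw [hη, div_mul_eq_mul_div, div_le_iff₀ (by positivity)]
    nlinarith
  set κ : ℝ := ε / 8 / (2 * b + 1) with hκ
  have hκ0 : 0 < κ := by positivity
  have hκb : ENNReal.ofReal (2 * b) * ENNReal.ofReal κ ≤ ENNReal.ofReal (ε / 8) := by
    rw [← ENNReal.ofReal_mul (by positivity)]
    apply ENNReal.ofReal_le_ofReal
    rw [hκ, ← mul_div_assoc, div_le_iff₀ (by positivity)]
    nlinarith
  obtain ⟨K, hKΩ, hK, hKlt⟩ := hΩ.exists_isCompact_sdiff_lt hΩt.ne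
    (ε := ENNReal.ofReal κ ^ p.toReal)
    (ENNReal.rpow_pos (ENNReal.ofReal_pos.2 hκ0) ENNReal.ofReal_ne_top).ne'
  -- equicontinuity
  obtain ⟨δ, hδ, hFδ⟩ := hFtrans (η / 4 / (C + 1)) (by positivity)
  have heq : ∀ f ∈ F, ∀ x x', dist x x' < δ →
      ‖(∫ y, f (x + y) ∂μ) - ∫ y, f (x' + y) ∂μ‖ ≤ η / 4 := by
    intro f hf x x' hx
    have h1 := (fkr_point p μ C hi hC f (hFmem f hf)).2 x x'
    have h2 := (hFδ f hf (x - x') (by rwa [← dist_eq_norm])).le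
    have h3 : ‖(∫ y, f (x + y) ∂μ) - ∫ y, f (x' + y) ∂μ‖ₑ ≤ ENNReal.ofReal (η / 4) := by
      refine h1.trans ((mul_le_mul_right h2 _).trans ?_)
      rw [← ENNReal.ofReal_mul hC0]
      apply ENNReal.ofReal_le_ofReal
      rw [← mul_div_assoc, div_le_iff₀ (by positivity)]
      nlinarith
    rw [← ofReal_norm] at h3
    exact (ENNReal.ofReal_le_ofReal_iff (by positivity)).1 h3
  obtain ⟨t, htK, htf, htc⟩ := hK.finite_cover_balls hδ
  haveI : Fintype t := htf.fintype
  -- discretization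
  obtain ⟨u, huB, huf, huc⟩ := (isCompact_closedBall (0 : t → ℝ) b).finite_cover_balls
    (e := η / 4) (by positivity)
  haveI : Fintype u := huf.fintype
  have hex : ∀ g : {g : Lp ℝ p ((volume : Measure (EuclideanSpace ℝ (Fin N))).restrict Ω) |
          ∃ f ∈ F, (g : EuclideanSpace ℝ (Fin N) → ℝ) =ᵐ[volume.restrict Ω] f},
      ∃ f : EuclideanSpace ℝ (Fin N) → ℝ, ∃ v : u, f ∈ F ∧
        ((g : Lp ℝ p ((volume : Measure (EuclideanSpace ℝ (Fin N))).restrict Ω)) :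
          EuclideanSpace ℝ (Fin N) → ℝ) =ᵐ[volume.restrict Ω] f ∧
        ∀ i : t, |(∫ y, f (i + y) ∂μ) - v.1 i| ≤ η / 4 := by
    rintro ⟨g, f, hf, hgf⟩
    have hmem : (fun i : t => ∫ y, f (i + y) ∂μ) ∈ Metric.closedBall (0 : t → ℝ) b := by
      rw [mem_closedBall_zero_iff, pi_norm_le_iff_of_nonneg hb0]
      intro i
      exact hpt f hf i
    obtain ⟨v, hv, hv2⟩ := Set.mem_iUnion₂.1 (huc hmem)
    refine ⟨f, ⟨v, hv⟩, hf, hgf, fun i => ?_⟩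
    have := (dist_le_pi_dist (fun i : t => ∫ y, f (i + y) ∂μ) v i).trans (Metric.mem_ball.1 hv2).le
    rwa [Real.dist_eq] at this
  choose φ v hφF hφ hφv using hex
  refine ⟨u, inferInstance, v, fun g g' hgg => ?_⟩
  have hTm : ∀ f ∈ F, AEStronglyMeasurable (fun x => ∫ y, f (x + y) ∂μ) volume := fun f hf =>
    (fkr_meas μ f (hFmem f hf).1).integral_prod_right'
  have hA : ∀ f ∈ F, eLpNorm (fun x => (∫ y, f (x + y) ∂μ) - f x) p (volume.restrict Ω) ≤
      ENNReal.ofReal (ε / 8) := fun f hf =>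
    (eLpNorm_mono_measure _ Measure.restrict_le_self).trans
      (fkr_dist p hp1.out hp r μ hac hμr hi f (hFmem f hf) _ fun x hx => (hFr f hf x hx).le)
  set f := φ g with hfdef
  set f' := φ g' with hfdef'
  have hf : f ∈ F := hφF g
  have hf' : f' ∈ F := hφF g'
  set D : EuclideanSpace ℝ (Fin N) → ℝ :=
    fun x => (∫ y, f (x + y) ∂μ) - ∫ y, f' (x + y) ∂μ with hD
  have hDm : AEStronglyMeasurable D volume := (hTm f hf).sub (hTm f' hf')
  have hDK : ∀ x ∈ K, ‖D x‖ ≤ η := by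
    intro x hx
    obtain ⟨i, hit, hxi⟩ := Set.mem_iUnion₂.1 (htc hx)
    have h1 := heq f hf x i hxi
    have h2 := heq f' hf' x i hxi
    have h3 := hφv g ⟨i, hit⟩
    have h4 := hφv g' ⟨i, hit⟩
    rw [← hgg] at h4
    simp only [Real.norm_eq_abs, abs_le, hD] at *
    constructor <;> linarith [h1.1, h1.2, h2.1, h2.2, h3.1, h3.2, h4.1, h4.2]
  have hDb : ∀ x, ‖D x‖ ≤ 2 * b := by
    intro x
    have := norm_sub_le (∫ y, f (x + y) ∂μ) (∫ y, f' (x + y) ∂μ)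
    have h1 := hpt f hf x
    have h2 := hpt f' hf' x
    simp only [hD]
    linarith
  have hKm : MeasurableSet K := hK.measurableSet
  have hD1 : eLpNorm (K.indicator D) p (volume.restrict Ω) ≤ ENNReal.ofReal (ε / 8) := by
    have h1 : ∀ᵐ x ∂(volume.restrict Ω), ‖K.indicator D x‖ₑ ≤ ENNReal.ofReal η := by
      refine Filter.Eventually.of_forall fun x => ?_
      by_cases hx : x ∈ K
      · rw [Set.indicator_of_mem hx, ← ofReal_norm]
        exact ENNReal.ofReal_le_ofReal (hDK x hx)
      · simp [hx]
    refine (eLpNorm_le_of_ae_enorm_bound h1).trans ?_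
    simpa using hηa
  have hD2 : eLpNorm (Kᶜ.indicator D) p (volume.restrict Ω) ≤ ENNReal.ofReal (ε / 8) := by
    rw [eLpNorm_indicator_eq_eLpNorm_restrict hKm.compl, Measure.restrict_restrict hKm.compl]
    have h1 : ∀ᵐ x ∂(volume.restrict (Kᶜ ∩ Ω)), ‖D x‖ₑ ≤ ENNReal.ofReal (2 * b) := by
      refine Filter.Eventually.of_forall fun x => ?_
      rw [← ofReal_norm]
      exact ENNReal.ofReal_le_ofReal (hDb x)
    refine (eLpNorm_le_of_ae_enorm_bound h1).trans ?_
    refine le_trans ?_ hκb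
    rw [smul_eq_mul]
    gcongr
    rw [ENNReal.rpow_inv_le_iff hq, Measure.restrict_apply_univ, Set.inter_comm,
      ← Set.sdiff_eq]
    exact hKlt.le
  have hDD : eLpNorm D p (volume.restrict Ω) ≤ ENNReal.ofReal (ε / 8) + ENNReal.ofReal (ε / 8) := by
    rw [← Set.indicator_self_add_compl K D]
    exact (eLpNorm_add_le (hDm.restrict.indicator hKm) (hDm.restrict.indicator hKm.compl)
      hp1.out).trans (add_le_add hD1 hD2)
  have hfm : ∀ f ∈ F, AEStronglyMeasurable f (volume.restrict Ω) := fun f hf =>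
    (hFmem f hf).1.restrict
  have hfin : edist (g : Lp ℝ p ((volume : Measure (EuclideanSpace ℝ (Fin N))).restrict Ω)) g' <
      ENNReal.ofReal ε := by
    rw [Lp.edist_def, eLpNorm_congr_ae ((hφ g).sub (hφ g'))]
    have hsplit : φ g - φ g' = (D + fun x => (∫ y, f' (x + y) ∂μ) - f' x) -
        fun x => (∫ y, f (x + y) ∂μ) - f x := by
      funext x
      simp only [hD, Pi.sub_apply, Pi.add_apply]
      ring
    rw [hsplit]
    have m1 := (hTm f hf).restrict (s := Ω) |>.sub (hfm f hf)
    have m2 := (hTm f' hf').restrict (s := Ω) |>.sub (hfm f' hf')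
    refine (eLpNorm_sub_le (hDm.restrict.add m2) m1 hp1.out).trans_lt ?_
    refine (add_le_add ((eLpNorm_add_le hDm.restrict m2 hp1.out).trans
      (add_le_add hDD (hA f' hf'))) (hA f hf)).trans_lt ?_
    rw [← ENNReal.ofReal_add he.le he.le, ← ENNReal.ofReal_add (by positivity) he.le,
      ← ENNReal.ofReal_add (by positivity) he.le]
    exact (ENNReal.ofReal_lt_ofReal_iff hε).2 (by linarith)
  rw [edist_dist] at hfin
  exact (ENNReal.ofReal_lt_ofReal_iff hε).1 hfin
end
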